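/- arXiv:0911.2253 — 4 statements merged into one kernel-verified Lean document; each statement's English description precedes it below -/
import Mathlib

section
/- For any 3×3 complex matrix A, tr((A ∗ A) ∘ A) = 3 det A; that is, the determinant satisfies det A = ⅓ tr((A ∗ A) ∘ A), expressing it entirely through the Jordan and Freudenthal products. -/
open Matrix

/-- The Jordan product of two square matrices: `A ∘ B = ½(AB + BA)`. -/
noncomputable def jordanProd (A B : Matrix (Fin 3) (Fin 3) ℂ) :
    Matrix (Fin 3) (Fin 3) ℂ :=
  (1 / 2 : ℂ) • (A * B + B * A)

/-- The Freudenthal product of `3×3` matrices: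
`A ∗ B = A ∘ B − ½((tr B) A + (tr A) B) + ½((tr A)(tr B) − tr(A ∘ B)) I`. -/
noncomputable def freudenthalProd (A B : Matrix (Fin 3) (Fin 3) ℂ) :
    Matrix (Fin 3) (Fin 3) ℂ :=
  jordanProd A B
    - (1 / 2 : ℂ) • (Matrix.trace B • A + Matrix.trace A • B)
    + ((1 / 2 : ℂ) * (Matrix.trace A * Matrix.trace B - Matrix.trace (jordanProd A B)))
        • (1 : Matrix (Fin 3) (Fin 3) ℂ)

/-- The Jordan square is the ordinary matrix square. -/
theorem jordanProd_self (A : Matrix (Fin 3) (Fin 3) ℂ) : jordanProd A A = A * A := by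
  rw [jordanProd, ← two_smul ℂ (A * A), smul_smul]
  norm_num

/-- The trace of a Jordan product is the trace of the ordinary product. -/
theorem trace_jordanProd (A B : Matrix (Fin 3) (Fin 3) ℂ) :
    trace (jordanProd A B) = trace (A * B) := by
  rw [jordanProd, trace_smul, trace_add, trace_mul_comm B A, smul_eq_mul]
  ring

/-- The determinant of a `3×3` complex matrix is expressed entirely through the
Jordan and Freudenthal products: `tr((A ∗ A) ∘ A) = 3 det A`. -/
theorem det_via_jordan_freudenthal (A : Matrix (Fin 3) (Fin 3) ℂ) :
    Matrix.trace (jordanProd (freudenthalProd A A) A) = 3 * Matrix.det A := by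
  rw [trace_jordanProd, freudenthalProd, jordanProd_self]
  simp only [add_mul, sub_mul, smul_mul_assoc, one_mul, trace_add, trace_sub, trace_smul,
    smul_eq_mul]
  simp only [trace_fin_three, det_fin_three, mul_apply, Fin.sum_univ_three]
  ring
end

section
/- Let V be a 3×3 complex Hermitian matrix with tr V = 1. Then V ∘ V = V (equivalently V² = V) if and only if V ∗ V = 0. That is, the two characterizations of points of the projective plane — as trace-1 idempotents and as trace-1 matrices with vanishing Freudenthal square — coincide. -/
open Matrix

/-- The Freudenthal square of a trace-one matrix, in terms of its Jordan square. -/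
theorem freudenthalProd_self_of_trace_eq_one {V : Matrix (Fin 3) (Fin 3) ℂ}
    (htr : Matrix.trace V = 1) :
    freudenthalProd V V = jordanProd V V - V
      + ((1 / 2 : ℂ) * (1 - Matrix.trace (jordanProd V V))) • (1 : Matrix (Fin 3) (Fin 3) ℂ) := by
  simp only [freudenthalProd, htr]
  module

/-- For a `3×3` Hermitian matrix `V` of trace `1`, idempotency `V ∘ V = V` is
equivalent to the vanishing of the Freudenthal square `V ∗ V = 0`:  the two
characterizations of points of the projective plane coincide. -/
theorem idempotent_iff_freudenthal_square_zero (V : Matrix (Fin 3) (Fin 3) ℂ)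
    (hherm : V.IsHermitian) (htr : Matrix.trace V = 1) :
    jordanProd V V = V ↔ freudenthalProd V V = 0 := by
  rw [freudenthalProd_self_of_trace_eq_one htr]
  constructor
  · intro h
    simp [h, htr]
  · intro h
    have htrace : Matrix.trace (jordanProd V V) = 1 := by
      have h' := congrArg Matrix.trace h
      simp only [trace_add, trace_sub, trace_smul, trace_one, trace_zero, htr, smul_eq_mul,
        Fintype.card_fin] at h'
      push_cast at h'
      linear_combination -2 * h'
    simpa [htrace, sub_eq_zero] using h
end

section
/- Jordan eigenvalues solve the characteristic equation: let A be a 3×3 complex Hermitian matrix, let V be a 3×3 complex Hermitian matrix with V² = V and tr V = 1, and suppose A ∘ V = λ V for a real number λ. Then det(A − λ I) = 0, i.e. λ is an eigenvalue of A in the ordinary sense. -/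
open Matrix

/-- Jordan eigenvalues solve the characteristic equation: if `A` is Hermitian,
`V` is a Hermitian primitive idempotent (`V² = V`, `tr V = 1`), and
`A ∘ V = λ V` for a real `λ`, then `det(A − λ I) = 0`. -/
theorem jordan_eigenvalue_solves_char_eq (A V : Matrix (Fin 3) (Fin 3) ℂ)
    (hA : A.IsHermitian) (hV : V.IsHermitian) (hidem : V ^ 2 = V)
    (htr : Matrix.trace V = 1) (lam : ℝ)
    (heig : jordanProd A V = (lam : ℂ) • V) :
    Matrix.det (A - (lam : ℂ) • (1 : Matrix (Fin 3) (Fin 3) ℂ)) = 0 := by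
  have hanti : (A - (lam : ℂ) • 1) * V + V * (A - (lam : ℂ) • 1) = 0 := by
    have hsum : A * V + V * A = (2 : ℂ) • (lam : ℂ) • V := by
      rw [← heig, jordanProd, smul_smul]
      norm_num
    rw [sub_mul, mul_sub, smul_mul_assoc, mul_smul_comm, one_mul, mul_one,
      sub_add_sub_comm, hsum, two_smul, sub_self]
  have hidem' : IsIdempotentElem V := (pow_two V).symm.trans hidem
  have hzero : (A - (lam : ℂ) • 1) * V = 0 := by
    have : IsAddTorsionFree (Matrix (Fin 3) (Fin 3) ℂ) :=
      inferInstanceAs (IsAddTorsionFree (Fin 3 → Fin 3 → ℂ))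
    have hVB := hidem'.mul_eq_zero_of_anticommute ((add_comm _ _).trans hanti)
    rwa [hVB, add_zero] at hanti
  by_contra hdet
  have hunit : IsUnit (A - (lam : ℂ) • (1 : Matrix (Fin 3) (Fin 3) ℂ)) :=
    (Matrix.isUnit_iff_isUnit_det _).mpr (isUnit_iff_ne_zero.mpr hdet)
  rw [hunit.mul_right_eq_zero.mp hzero, Matrix.trace_zero] at htr
  exact zero_ne_one htr
end

section
/- General solution of the massless momentum-space Dirac equation: let P be a nonzero 2×2 complex Hermitian positive-semidefinite matrix with det P = 0, and let ψ ∈ ℂ² satisfy P̃ ψ = 0, where P̃ = P − (tr P) I is the trace reversal of P. Then there exist θ ∈ ℂ² and ξ ∈ ℂ such that P = θ θ† and ψ = ξ θ. -/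
open Matrix
open scoped ComplexOrder

namespace Matrix

theorem mul_apply_self_eq_of_det_eq_zero {R : Type*} [CommRing R] {P : Matrix (Fin 2) (Fin 2) R}
    (hdet : P.det = 0) (i j k : Fin 2) : P j k * P i i = P j i * P i k := by
  rw [det_fin_two] at hdet
  fin_cases i <;> fin_cases j <;> fin_cases k <;> simp only [Fin.zero_eta, Fin.mk_one] <;>
    first | ring | linear_combination hdet

theorem PosSemidef.exists_diag_ne_zero {n : Type*} [Fintype n] {P : Matrix n n ℂ}
    (hP : P.PosSemidef) (hP0 : P ≠ 0) : ∃ i, P i i ≠ 0 := by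
  by_contra! h
  exact hP0 (hP.trace_eq_zero_iff.mp (Finset.sum_eq_zero fun i _ => h i))

/-- A singular positive semidefinite `2 × 2` matrix is of the form `θ θ†`. -/
theorem PosSemidef.exists_eq_vecMulVec_of_det_eq_zero {P : Matrix (Fin 2) (Fin 2) ℂ}
    (hP : P.PosSemidef) (hdet : P.det = 0) : ∃ θ : Fin 2 → ℂ, P = vecMulVec θ (star θ) := by
  rcases eq_or_ne P 0 with rfl | hP0
  · exact ⟨0, by simp⟩
  obtain ⟨i, hi⟩ := hP.exists_diag_ne_zero hP0
  obtain ⟨r, hr, hri⟩ := RCLike.nonneg_iff_exists_ofReal.mp (hP.diag_nonneg (i := i))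
  have hsq : ((√r : ℝ) : ℂ) * (√r : ℝ) = P i i := by
    rw [← Complex.ofReal_mul, Real.mul_self_sqrt hr]
    exact hri
  refine ⟨fun j => P j i / (√r : ℝ), ?_⟩
  ext j k
  have hk : star (P k i) = P i k := hP.isHermitian.apply i k
  rw [vecMulVec_apply, Pi.star_apply, star_div₀, hk,
    show star ((√r : ℝ) : ℂ) = (√r : ℝ) from Complex.conj_ofReal _, div_mul_div_comm, hsq,
    eq_div_iff hi, mul_apply_self_eq_of_det_eq_zero hdet]

end Matrix

/-- General solution of the massless momentum-space Dirac equation: if `P ≠ 0` is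
a `2×2` Hermitian positive-semidefinite matrix with `det P = 0` and `ψ ∈ ℂ²`
satisfies `P̃ ψ = 0`, where `P̃ = P − (tr P) I` is the trace reversal, then
`P = θ θ†` and `ψ = ξ θ` for some `θ ∈ ℂ²` and `ξ ∈ ℂ`. -/
theorem massless_dirac_general_solution (P : Matrix (Fin 2) (Fin 2) ℂ)
    (hP : P.PosSemidef) (hP0 : P ≠ 0) (hdet : Matrix.det P = 0)
    (ψ : Fin 2 → ℂ)
    (hdirac : (P - Matrix.trace P • (1 : Matrix (Fin 2) (Fin 2) ℂ)).mulVec ψ = 0) :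
    ∃ (θ : Fin 2 → ℂ) (ξ : ℂ), P = vecMulVec θ (star θ) ∧ ψ = ξ • θ := by
  obtain ⟨θ, hθ⟩ := hP.exists_eq_vecMulVec_of_det_eq_zero hdet
  have htr : P.trace ≠ 0 := mt hP.trace_eq_zero_iff.mp hP0
  refine ⟨θ, (star θ ⬝ᵥ ψ) / P.trace, hθ, ?_⟩
  have hev : P *ᵥ ψ = P.trace • ψ := by
    rwa [sub_mulVec, smul_mulVec, one_mulVec, sub_eq_zero] at hdirac
  have hrank : P *ᵥ ψ = (star θ ⬝ᵥ ψ) • θ := by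
    rw [hθ, vecMulVec_mulVec, op_smul_eq_smul]
  rw [div_eq_inv_mul, mul_smul, ← hrank, hev, inv_smul_smul₀ htr]
end
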